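/- There is an absolute constant C with the following property. Let μ be a C¹ complex-valued function on ℝ³ ∖ {0}; set m(r) := r^{−2} ∫_{|x|=r} |μ|² dσ_x for r > 0, A := ∫_{ℝ³} |∇μ(x)|²/|x|² dx, and M := sup_{r>0} ∫_r^{r+1} m(t) dt. If A < ∞ and M < ∞, then sup_{r>0} m(r) ≤ C ( M + √(A M) ). -/

import Mathlib

open MeasureTheory Metric

noncomputable section

/-- `m(r) = r⁻² ∫_{|x|=r} |μ|² dσ` with surface measure `μH[2]`. -/
def sphAvg (μ : EuclideanSpace ℝ (Fin 3) → ℂ) (r : ℝ) : ℝ :=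
  (r ^ 2)⁻¹ * ∫ x in sphere (0 : EuclideanSpace ℝ (Fin 3)) r, ‖μ x‖ ^ 2 ∂μH[2]

/-- `A = ∫_{ℝ³} |∇μ|²/|x|² dx`. -/
def Aint (μ : EuclideanSpace ℝ (Fin 3) → ℂ) : ℝ :=
  ∫ x : EuclideanSpace ℝ (Fin 3), ‖fderiv ℝ μ x‖ ^ 2 / ‖x‖ ^ 2

/-- The set of values `∫_r^{r+1} m(t) dt` for `r > 0`, whose supremum is `M`. -/
def Mset (μ : EuclideanSpace ℝ (Fin 3) → ℂ) : Set ℝ :=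
  {y : ℝ | ∃ r : ℝ, 0 < r ∧ y = ∫ t in r..(r + 1), sphAvg μ t}

/-- `M = sup_{r>0} ∫_r^{r+1} m(t) dt`. -/
def Msup (μ : EuclideanSpace ℝ (Fin 3) → ℂ) : ℝ := sSup (Mset μ)

end


open scoped ENNReal NNReal Pointwise

namespace Stmt10

abbrev E3 := EuclideanSpace ℝ (Fin 3)

abbrev S2 := sphere (0 : E3) 1

/-- the point of the cube face -/
noncomputable def vec (i : Fin 3) (e : ℝ) (y : Fin 2 → ℝ) : E3 :=
  WithLp.toLp 2 (i.insertNth (α := fun _ => ℝ) e y)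

lemma vec_same (i : Fin 3) (e : ℝ) (y : Fin 2 → ℝ) : vec i e y i = e := by
  simp [vec]

lemma vec_succAbove (i : Fin 3) (e : ℝ) (y : Fin 2 → ℝ) (j : Fin 2) :
    vec i e y (i.succAbove j) = y j := by
  simp [vec]

lemma vec_norm_sq (i : Fin 3) (e : ℝ) (y : Fin 2 → ℝ) :
    ‖vec i e y‖ ^ 2 = e ^ 2 + (y 0 ^ 2 + y 1 ^ 2) := by
  rw [EuclideanSpace.norm_sq_eq, Fin.sum_univ_succAbove _ i, Fin.sum_univ_two]
  simp [vec_same, vec_succAbove]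

lemma one_le_norm_vec (i : Fin 3) {e : ℝ} (he : e ^ 2 = 1) (y : Fin 2 → ℝ) :
    1 ≤ ‖vec i e y‖ := by
  have := vec_norm_sq i e y
  have h2 : 1 ≤ ‖vec i e y‖ ^ 2 := by rw [this, he]; nlinarith [sq_nonneg (y 0), sq_nonneg (y 1)]
  exact (one_le_sq_iff₀ (norm_nonneg _)).1 h2

lemma vec_sub (i : Fin 3) (e : ℝ) (y z : Fin 2 → ℝ) :
    vec i e y - vec i e z = vec i 0 (y - z) := by
  ext k
  rcases Fin.eq_self_or_eq_succAbove i k with rfl | ⟨j, rfl⟩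
  · simp [vec_same]
  · simp [vec_succAbove]

lemma vec_smul (i : Fin 3) (e c : ℝ) (y : Fin 2 → ℝ) :
    c • vec i e y = vec i (c * e) (c • y) := by
  ext k
  rcases Fin.eq_self_or_eq_succAbove i k with rfl | ⟨j, rfl⟩
  · simp [vec_same]
  · simp [vec_succAbove]

lemma norm_vec_sub_le (i : Fin 3) (e : ℝ) (y z : Fin 2 → ℝ) :
    ‖vec i e y - vec i e z‖ ≤ 2 * ‖y - z‖ := by
  rw [vec_sub]
  have h := vec_norm_sq i 0 (y - z)
  have h0 : |(y - z) 0| ≤ ‖y - z‖ := norm_le_pi_norm (y - z) 0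
  have h1 : |(y - z) 1| ≤ ‖y - z‖ := norm_le_pi_norm (y - z) 1
  have h0' := sq_le_sq' (abs_le.1 h0).1 (abs_le.1 h0).2
  have h1' := sq_le_sq' (abs_le.1 h1).1 (abs_le.1 h1).2
  have hn := norm_nonneg (y - z)
  apply abs_le_of_sq_le_sq' _ (by positivity) |>.2
  nlinarith

lemma normalize_lip {v w : E3} (hv : 1 ≤ ‖v‖) (hw : 1 ≤ ‖w‖) :
    ‖‖v‖⁻¹ • v - ‖w‖⁻¹ • w‖ ≤ 2 * ‖v - w‖ := by
  have hv0 : ‖v‖ ≠ 0 := by positivity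
  have hw0 : ‖w‖ ≠ 0 := by positivity
  have e1 : ‖v‖⁻¹ • v - ‖w‖⁻¹ • w = ‖v‖⁻¹ • (v - w) + (‖v‖⁻¹ * (‖w‖ - ‖v‖)) • (‖w‖⁻¹ • w) := by
    rw [smul_smul, smul_sub, sub_add, ← sub_smul]
    congr 2
    field_simp
    ring
  rw [e1]
  refine (norm_add_le _ _).trans ?_
  have hi : ‖v‖⁻¹ ≤ 1 := inv_le_one_of_one_le₀ hv
  have hi0 : 0 ≤ ‖v‖⁻¹ := by positivity
  rw [norm_smul, norm_smul, norm_smul, norm_inv, norm_norm, norm_inv, norm_norm,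
    inv_mul_cancel₀ hw0, norm_mul, norm_inv, norm_norm, Real.norm_eq_abs]
  have h3 : |‖w‖ - ‖v‖| ≤ ‖v - w‖ := by
    rw [norm_sub_rev]; exact abs_norm_sub_norm_le w v
  have := abs_nonneg (‖w‖ - ‖v‖)
  nlinarith [norm_nonneg (v - w)]

noncomputable def psi (i : Fin 3) (e : ℝ) (he : e ^ 2 = 1) (y : Fin 2 → ℝ) : S2 :=
  ⟨‖vec i e y‖⁻¹ • vec i e y, by
    have := one_le_norm_vec i he y
    have h0 : ‖vec i e y‖ ≠ 0 := by positivity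
    simp [norm_smul, h0]⟩

lemma psi_lip (i : Fin 3) (e : ℝ) (he : e ^ 2 = 1) : LipschitzWith 4 (psi i e he) := by
  refine LipschitzWith.of_dist_le_mul fun y z => ?_
  rw [Subtype.dist_eq, dist_eq_norm, dist_eq_norm]
  refine (normalize_lip (one_le_norm_vec i he y) (one_le_norm_vec i he z)).trans ?_
  have := norm_vec_sub_le i e y z
  norm_num
  linarith

lemma vol_cone (i : Fin 3) (e : ℝ) (he : e ^ 2 = 1) (F : Set (Fin 2 → ℝ)) (hF : MeasurableSet F)
    (hF1 : ∀ y ∈ F, ∀ j, |y j| ≤ 1) :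
    volume F ≤ 64 * volume (Set.Ioo (0 : ℝ) 1 • ((↑) '' (psi i e he '' F) : Set E3)) := by
  set T : Set (ℝ × (Fin 2 → ℝ)) := {p | e * p.1 ∈ Set.Ioo (1/4 : ℝ) (1/2) ∧ (e * p.1)⁻¹ • p.2 ∈ F}
    with hT
  have hTm : MeasurableSet T := by
    apply MeasurableSet.inter
    · exact measurableSet_Ioo.preimage (by fun_prop)
    · exact hF.preimage (by fun_prop)
  have hsub : (fun p : ℝ × (Fin 2 → ℝ) => vec i p.1 p.2) '' T ⊆
      Set.Ioo (0 : ℝ) 1 • ((↑) '' (psi i e he '' F) : Set E3) := by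
    rintro _ ⟨⟨u, y'⟩, ⟨hu, hy⟩, rfl⟩
    simp only at hu hy
    set s := e * u with hs
    have hs0 : 0 < s := by linarith [hu.1]
    set y := s⁻¹ • y' with hy'
    have hn1 := one_le_norm_vec i he y
    have hn := vec_norm_sq i e y
    have hy0 := hF1 y hy 0
    have hy1 := hF1 y hy 1
    have hlt : ‖vec i e y‖ < 2 := by
      apply abs_lt_of_sq_lt_sq' _ (by norm_num) |>.2
      have a0 := sq_le_sq' (abs_le.1 hy0).1 (abs_le.1 hy0).2
      have a1 := sq_le_sq' (abs_le.1 hy1).1 (abs_le.1 hy1).2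
      nlinarith
    refine ⟨s * ‖vec i e y‖, ⟨by positivity, by nlinarith [hu.2]⟩, psi i e he y,
      ⟨_, ⟨y, hy, rfl⟩, rfl⟩, ?_⟩
    have h0 : ‖vec i e y‖ ≠ 0 := by positivity
    simp only [psi, smul_smul]
    rw [mul_assoc, mul_inv_cancel₀ h0, mul_one, vec_smul, hy', smul_smul, mul_inv_cancel₀ hs0.ne',
      one_smul, hs]
    congr 1
    linear_combination u * he
  have hvol : volume ((fun p : ℝ × (Fin 2 → ℝ) => vec i p.1 p.2) '' T) = volume T := by
    have e1 : (fun p : ℝ × (Fin 2 → ℝ) => vec i p.1 p.2) '' T =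
        (MeasurableEquiv.toLp 2 (Fin 3 → ℝ)) ''
          ((MeasurableEquiv.piFinSuccAbove (fun _ => ℝ) i).symm '' T) := by
      rw [Set.image_image]
      rfl
    rw [e1, MeasurableEquiv.image_eq_preimage_symm, MeasurableEquiv.image_symm,
      (EuclideanSpace.volume_preserving_symm_measurableEquiv_toLp (Fin 3)).measure_preimage_equiv,
      (volume_preserving_piFinSuccAbove (fun _ : Fin 3 => ℝ) i).measure_preimage_equiv]
  have hTv : volume F ≤ 64 * volume T := by
    have hslice : ∀ u : ℝ, e * u ∈ Set.Ioo (1/4 : ℝ) (1/2) →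
        16⁻¹ * volume F ≤ volume (Prod.mk u ⁻¹' T) := by
      intro u hu
      have hs0 : 0 < e * u := by linarith [hu.1]
      have : Prod.mk u ⁻¹' T = (e * u) • F := by
        ext y
        simp only [hT, Set.mem_preimage, Set.mem_ofPred_eq, hu, true_and]
        rw [Set.mem_smul_set_iff_inv_smul_mem₀ hs0.ne']
      rw [this, Measure.addHaar_smul]
      gcongr
      rw [show (16⁻¹ : ℝ≥0∞) = ENNReal.ofReal (16⁻¹) by
        rw [ENNReal.ofReal_inv_of_pos (by norm_num)]; norm_num]
      apply ENNReal.ofReal_le_ofReal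
      simp only [Module.finrank_fintype_fun_eq_card, Fintype.card_fin]
      rw [abs_of_nonneg (by positivity)]
      nlinarith [hu.1]
    set I : Set ℝ := {u | e * u ∈ Set.Ioo (1/4 : ℝ) (1/2)} with hI
    have hIm : MeasurableSet I := measurableSet_Ioo.preimage (by fun_prop)
    have hIv : volume I = 4⁻¹ := by
      have e4 : (4⁻¹ : ℝ≥0∞) = ENNReal.ofReal (1/2 - 1/4) := by
        rw [show (1/2 - 1/4 : ℝ) = 4⁻¹ by norm_num, ENNReal.ofReal_inv_of_pos (by norm_num)]
        norm_num
      rcases mul_self_eq_one_iff.1 (by rw [← sq]; exact he : e * e = 1) with rfl | rfl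
      · simp only [hI, one_mul, Set.ofPred_mem_eq, Real.volume_Ioo, e4]
      · have : I = Set.Ioo (-(1/2)) (-(1/4)) := by
          ext u; simp only [hI, Set.mem_ofPred_eq, Set.mem_Ioo]
          constructor <;> rintro ⟨h1, h2⟩ <;> constructor <;> linarith
        rw [this, Real.volume_Ioo, e4]; congr 1; norm_num
    have : 16⁻¹ * volume F * 4⁻¹ ≤ volume T := by
      rw [Measure.volume_eq_prod, Measure.prod_apply hTm, ← hIv, ← setLIntegral_const]
      refine le_trans ?_ (setLIntegral_le_lintegral I _)
      exact setLIntegral_mono' hIm hslice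
    calc volume F = 64 * (16⁻¹ * volume F * 4⁻¹) := by
          have : (64 : ℝ≥0∞) * (16⁻¹ * 4⁻¹) = 1 := by
            rw [← ENNReal.mul_inv (by simp) (by simp)]
            norm_num
            exact ENNReal.mul_inv_cancel (by simp) (by simp)
          calc volume F = ((64 : ℝ≥0∞) * (16⁻¹ * 4⁻¹)) * volume F := by rw [this, one_mul]
            _ = _ := by ring
      _ ≤ _ := by gcongr
  calc volume F ≤ 64 * volume T := hTv
    _ = 64 * volume ((fun p : ℝ × (Fin 2 → ℝ) => vec i p.1 p.2) '' T) := by rw [hvol]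
    _ ≤ _ := by gcongr

lemma patch (i : Fin 3) (e : ℝ) (he : e ^ 2 = 1) (E : Set S2) (hE : MeasurableSet E) :
    (μH[2] : Measure S2) (E ∩ {w | ∀ j, |w.1 j| ≤ e * w.1 i}) ≤
      1024 * (volume : Measure E3).toSphere E := by
  set F : Set (Fin 2 → ℝ) := {y | ∀ j, |y j| ≤ 1} ∩ psi i e he ⁻¹' E with hFdef
  have hF : MeasurableSet F := by
    apply MeasurableSet.inter
    · rw [Set.ofPred_forall]
      exact MeasurableSet.iInter fun j => measurableSet_le (by fun_prop) (by fun_prop)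
    · exact (psi_lip i e he).continuous.measurable hE
  have hsub : E ∩ {w | ∀ j, |w.1 j| ≤ e * w.1 i} ⊆ psi i e he '' F := by
    rintro w ⟨hwE, hw⟩
    simp only [Set.mem_ofPred_eq] at hw
    set s := e * w.1 i with hs
    have hs0 : 0 < s := by
      by_contra hcon
      have h0 : w.1 = 0 := by
        ext j
        have := hw j
        have h2 := abs_nonneg (w.1 j)
        simpa using abs_eq_zero.1 (by linarith)
      have := norm_eq_of_mem_sphere w
      rw [h0] at this
      simp at this
    set y : Fin 2 → ℝ := fun j => s⁻¹ * w.1 (i.succAbove j) with hy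
    have hvec : vec i e y = s⁻¹ • w.1 := by
      ext k
      rcases Fin.eq_self_or_eq_succAbove i k with rfl | ⟨j, rfl⟩
      · rw [vec_same]
        simp only [PiLp.smul_apply, smul_eq_mul]
        field_simp
        rw [hs]; linear_combination (w.1 k) * he
      · simp [vec_succAbove, hy]
    have hpsi : psi i e he y = w := by
      apply Subtype.ext
      simp only [psi]
      rw [hvec, norm_smul, norm_eq_of_mem_sphere w, smul_smul, norm_inv, Real.norm_eq_abs,
        abs_of_pos hs0]
      rw [mul_one, inv_inv, mul_inv_cancel₀ hs0.ne', one_smul]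
    refine ⟨y, ⟨fun j => ?_, ?_⟩, hpsi⟩
    · simp only [hy]
      rw [abs_mul, abs_of_pos (inv_pos.2 hs0), inv_mul_le_iff₀ hs0, mul_one]
      exact hw _
    · rw [Set.mem_preimage, hpsi]; exact hwE
  have h1 := (psi_lip i e he).hausdorffMeasure_image_le (d := 2) (by norm_num) F
  have h2 : (μH[2] : Measure (Fin 2 → ℝ)) = volume := by
    have := hausdorffMeasure_pi_real (ι := Fin 2)
    simpa using this
  have h3 := vol_cone i e he F hF (fun y hy => hy.1)
  calc (μH[2] : Measure S2) (E ∩ {w | ∀ j, |w.1 j| ≤ e * w.1 i})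
      ≤ μH[2] (psi i e he '' F) := measure_mono hsub
    _ ≤ _ := h1
    _ = 16 * volume F := by
      rw [h2]; congr 1; norm_num
    _ ≤ 16 * (64 * volume (Set.Ioo (0 : ℝ) 1 • ((↑) '' (psi i e he '' F) : Set E3))) := by gcongr
    _ ≤ 16 * (64 * volume (Set.Ioo (0 : ℝ) 1 • ((↑) '' E : Set E3))) := by
      gcongr
      rintro _ ⟨y, hy, rfl⟩
      exact hy.2
    _ ≤ _ := by
      rw [Measure.toSphere_apply' _ hE, ← mul_assoc, show (16 * 64 : ℝ≥0∞) = 1024 by norm_num]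
      gcongr
      exact le_mul_of_one_le_left (by simp) (by simp)

lemma haus_le : (μH[2] : Measure S2) ≤ (6144 : ℝ≥0∞) • (volume : Measure E3).toSphere := by
  refine Measure.le_iff.2 fun E hE => ?_
  have hcov : E ⊆ ⋃ p : Fin 3 × Bool,
      E ∩ {w : S2 | ∀ j, |w.1 j| ≤ (if p.2 then (1:ℝ) else -1) * w.1 p.1} := by
    intro w hw
    obtain ⟨i, hi⟩ := Finite.exists_max (fun j => |w.1 j|)
    refine Set.mem_iUnion.2 ⟨(i, decide (0 ≤ w.1 i)), hw, fun j => ?_⟩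
    refine (hi j).trans ?_
    by_cases h : 0 ≤ w.1 i
    · simp [h, abs_of_nonneg h]
    · simp [h, abs_of_neg (not_le.1 h)]
  calc (μH[2] : Measure S2) E ≤ _ := measure_mono hcov
    _ ≤ _ := measure_iUnion_le _
    _ ≤ ∑' p : Fin 3 × Bool, 1024 * (volume : Measure E3).toSphere E := by
      refine ENNReal.tsum_le_tsum fun p => patch p.1 _ ?_ E hE
      split_ifs <;> norm_num
    _ = _ := by
      rw [tsum_fintype]
      simp [← mul_assoc]
      norm_num

instance : IsFiniteMeasure (μH[2] : Measure S2) :=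
  ⟨(haus_le Set.univ).trans_lt (by
    rw [Measure.smul_apply, smul_eq_mul]
    exact ENNReal.mul_lt_top (by simp) (measure_lt_top _ _))⟩

lemma sphAvg_eq (μ : E3 → ℂ) {r : ℝ} (hr : 0 < r) :
    sphAvg μ r = ∫ w : S2, ‖μ (r • w.1)‖ ^ 2 ∂μH[2] := by
  set f : S2 → E3 := fun w => r • w.1 with hf
  have hfc : Continuous f := by fun_prop
  have hfi : Function.Injective f := fun a b hab =>
    Subtype.ext (smul_right_injective E3 hr.ne' hab)
  have hemb : MeasurableEmbedding f := (hfc.isClosedEmbedding hfi).measurableEmbedding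
  have hmap : Measure.map f (μH[2] : Measure S2) =
      ENNReal.ofReal ((r ^ 2)⁻¹) • (μH[2] : Measure E3).restrict (sphere 0 r) := by
    ext B hB
    rw [hemb.map_apply, Measure.smul_apply, Measure.restrict_apply hB]
    have e1 : B ∩ sphere (0 : E3) r = r • ((↑) '' (f ⁻¹' B) : Set E3) := by
      ext x
      constructor
      · rintro ⟨hx, hxr⟩
        have hxr' : ‖x‖ = r := by simpa using hxr
        refine ⟨r⁻¹ • x, ⟨⟨r⁻¹ • x, ?_⟩, ?_, rfl⟩, ?_⟩
        · simp [norm_smul, hxr', abs_of_pos hr, hr.ne']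
        · simp [f, smul_smul, hr.ne', hx]
        · simp [smul_smul, hr.ne']
      · rintro ⟨_, ⟨w, hw, rfl⟩, rfl⟩
        refine ⟨hw, ?_⟩
        have := norm_eq_of_mem_sphere w
        simp [norm_smul, abs_of_pos hr]
    rw [e1, Measure.hausdorffMeasure_smul₀ (by norm_num) hr.ne',
      isometry_subtype_coe.hausdorffMeasure_image (Or.inl (by norm_num))]
    rw [ENNReal.smul_def, smul_eq_mul, smul_eq_mul, ← mul_assoc]
    have : ENNReal.ofReal ((r ^ 2)⁻¹) * ((‖r‖₊ ^ (2:ℝ) : ℝ≥0) : ℝ≥0∞) = 1 := by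
      have h2 : ((‖r‖₊ ^ (2:ℝ) : ℝ≥0) : ℝ≥0∞) = ENNReal.ofReal (r ^ 2) := by
        rw [ENNReal.ofReal, ENNReal.coe_inj]
        ext
        rw [Real.coe_toNNReal _ (by positivity)]
        simp
      rw [h2, ← ENNReal.ofReal_mul (by positivity), inv_mul_cancel₀ (by positivity),
        ENNReal.ofReal_one]
    rw [this, one_mul]
  have := hemb.integral_map (μ := (μH[2] : Measure S2)) (fun x => ‖μ x‖ ^ 2)
  rw [← this, hmap, integral_smul_measure, ENNReal.toReal_ofReal (by positivity)]
  rfl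

lemma polar (G : E3 → ℝ≥0∞) (hG : Measurable G) :
    ∫⁻ x, G x = ∫⁻ w : S2, (∫⁻ t in Set.Ioi (0 : ℝ), ENNReal.ofReal (t ^ 2) * G (t • w.1))
      ∂(volume : Measure E3).toSphere := by
  have h1 : ∫⁻ x, G x = ∫⁻ x : ({(0 : E3)}ᶜ : Set E3), G x.1 ∂((volume : Measure E3).comap (↑)) := by
    rw [lintegral_subtype_comap (measurableSet_singleton _).compl, restrict_compl_singleton]
  have hmp := (volume : Measure E3).measurePreserving_homeomorphUnitSphereProd
  have h2 := hmp.lintegral_comp_emb (Homeomorph.measurableEmbedding _)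
    (fun p : S2 × Set.Ioi (0 : ℝ) => G (p.2.1 • p.1.1))
  have h3 : ∀ x : ({(0 : E3)}ᶜ : Set E3),
      ((homeomorphUnitSphereProd E3 x).2.1 • (homeomorphUnitSphereProd E3 x).1.1 : E3) = x.1 := by
    intro x
    have hx : ‖x.1‖ ≠ 0 := norm_ne_zero_iff.2 x.2
    simp [smul_smul, hx]
  simp only [h3] at h2
  have hm : Measurable (fun p : S2 × Set.Ioi (0 : ℝ) => G (p.2.1 • p.1.1)) :=
    hG.comp (by fun_prop)
  rw [h1, h2, lintegral_prod _ hm.aemeasurable]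
  refine lintegral_congr fun w => ?_
  have hd : Module.finrank ℝ E3 - 1 = 2 := by simp
  rw [hd, Measure.volumeIoiPow, lintegral_withDensity_eq_lintegral_mul _ (by fun_prop)
    (show Measurable fun y : Set.Ioi (0 : ℝ) => G ((w, y).2.1 • (w, y).1.1) from
      hG.comp (by fun_prop))]
  simp only [Pi.mul_apply]
  rw [lintegral_subtype_comap measurableSet_Ioi
    (fun t : ℝ => ENNReal.ofReal (t ^ 2) * G (t • w.1))]

/-- bound of the energy on a shell -/
lemma energy (μ : E3 → ℂ) {r : ℝ} (hr : 0 < r)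
    (hA : Integrable (fun x : E3 => ‖fderiv ℝ μ x‖ ^ 2 / ‖x‖ ^ 2)) :
    ∫ p : S2 × ℝ, ‖fderiv ℝ μ (p.2 • p.1.1)‖ ^ 2
      ∂((μH[2] : Measure S2).prod (volume.restrict (Set.Ioc r (r + 1)))) ≤ 6144 * Aint μ := by
  have hgm : Measurable (fderiv ℝ μ) := measurable_fderiv ℝ μ
  have hA0 : 0 ≤ Aint μ := integral_nonneg fun x => by positivity
  have hm : Measurable fun p : S2 × ℝ => ‖fderiv ℝ μ (p.2 • p.1.1)‖ ^ 2 :=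
    ((hgm.comp (by fun_prop : Measurable fun p : S2 × ℝ => p.2 • p.1.1)).norm).pow_const 2
  rw [integral_eq_lintegral_of_nonneg_ae (Filter.Eventually.of_forall fun p => by positivity)
    hm.aestronglyMeasurable]
  apply ENNReal.toReal_le_of_le_ofReal (by positivity)
  have hAe : ENNReal.ofReal (Aint μ) =
      ∫⁻ x : E3, ENNReal.ofReal (‖fderiv ℝ μ x‖ ^ 2 / ‖x‖ ^ 2) :=
    ofReal_integral_eq_lintegral_ofReal hA (Filter.Eventually.of_forall fun x => by positivity)
  rw [ENNReal.ofReal_mul (by norm_num), hAe, polar _ (by fun_prop)]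
  calc _ ≤ ∫⁻ p : S2 × ℝ, ENNReal.ofReal (‖fderiv ℝ μ (p.2 • p.1.1)‖ ^ 2)
        ∂(((6144 : ℝ≥0∞) • (volume : Measure E3).toSphere).prod
          (volume.restrict (Set.Ioc r (r + 1)))) :=
        lintegral_mono' (Measure.prod_mono haus_le le_rfl) le_rfl
    _ = 6144 * ∫⁻ p : S2 × ℝ, ENNReal.ofReal (‖fderiv ℝ μ (p.2 • p.1.1)‖ ^ 2)
        ∂((volume : Measure E3).toSphere.prod (volume.restrict (Set.Ioc r (r + 1)))) := by
        rw [Measure.prod_smul_left, lintegral_smul_measure, smul_eq_mul]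
    _ ≤ _ := by
        rw [show ENNReal.ofReal 6144 = 6144 by norm_num,
          lintegral_prod _ hm.ennreal_ofReal.aemeasurable]
        refine mul_le_mul' le_rfl (lintegral_mono fun w => ?_)
        refine le_trans (le_of_eq ?_) (lintegral_mono_set (s := Set.Ioc r (r + 1))
          (t := Set.Ioi 0) fun t ht => hr.trans ht.1)
        refine setLIntegral_congr_fun measurableSet_Ioc fun t ht => ?_
        have ht0 : 0 < t := hr.trans ht.1
        simp only
        rw [← ENNReal.ofReal_mul (by positivity)]
        congr 1
        rw [norm_smul, norm_eq_of_mem_sphere w, Real.norm_eq_abs, abs_of_pos ht0]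
        field_simp

lemma pointwise (μ : E3 → ℂ) (hμ : ContDiffOn ℝ 1 μ {x : E3 | x ≠ 0}) {r : ℝ} (hr : 0 < r)
    (w : S2) :
    ‖μ (r • w.1)‖ ^ 2 ≤ ∫ t in Set.Ioc r (r + 1),
      (‖μ (t • w.1)‖ ^ 2 + 2 * (‖μ (t • w.1)‖ * ‖fderiv ℝ μ (t • w.1)‖)) := by
  have hopen : IsOpen {x : E3 | x ≠ 0} := isOpen_ne
  have hc : ContinuousOn μ {x : E3 | x ≠ 0} := hμ.continuousOn
  have hdc : ContinuousOn (fderiv ℝ μ) {x : E3 | x ≠ 0} :=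
    hμ.continuousOn_fderiv_of_isOpen hopen le_rfl
  have hw0 : w.1 ≠ 0 := by
    intro h
    have := norm_eq_of_mem_sphere w
    rw [h] at this
    simp at this
  have hIcc : Set.uIcc r (r + 1) = Set.Icc r (r + 1) := Set.uIcc_of_le (by linarith)
  have hmaps : Set.MapsTo (fun t : ℝ => t • w.1) (Set.uIcc r (r + 1)) {x : E3 | x ≠ 0} := by
    intro t ht
    rw [hIcc] at ht
    exact smul_ne_zero (hr.trans_le ht.1).ne' hw0
  have hsc : ContinuousOn (fun t : ℝ => t • w.1) (Set.uIcc r (r + 1)) := by fun_prop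
  have c1 : ContinuousOn (fun t : ℝ => μ (t • w.1)) (Set.uIcc r (r + 1)) := hc.comp hsc hmaps
  have c2 : ContinuousOn (fun t : ℝ => fderiv ℝ μ (t • w.1)) (Set.uIcc r (r + 1)) :=
    hdc.comp hsc hmaps
  have c3 : ContinuousOn (fun t : ℝ => fderiv ℝ μ (t • w.1) w.1) (Set.uIcc r (r + 1)) :=
    c2.clm_apply continuousOn_const
  set D : ℝ → ℝ := fun t => (-1) * ‖μ (t • w.1)‖ ^ 2 +
    (r + 1 - t) * (2 * inner ℝ (μ (t • w.1)) (fderiv ℝ μ (t • w.1) w.1)) with hD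
  have hDc : ContinuousOn D (Set.uIcc r (r + 1)) := by
    have := c1.inner (𝕜 := ℝ) c3
    fun_prop
  have hder : ∀ t ∈ Set.uIcc r (r + 1),
      HasDerivAt (fun t => (r + 1 - t) * ‖μ (t • w.1)‖ ^ 2) (D t) t := by
    intro t ht
    have hx := hmaps ht
    have hd : HasFDerivAt μ (fderiv ℝ μ (t • w.1)) (t • w.1) :=
      ((hμ.differentiableOn one_ne_zero).differentiableAt (hopen.mem_nhds hx)).hasFDerivAt
    have hl : HasDerivAt (fun t : ℝ => t • w.1) w.1 t := by
      simpa using (hasDerivAt_id t).smul_const w.1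
    have h1 : HasDerivAt (fun t : ℝ => μ (t • w.1)) (fderiv ℝ μ (t • w.1) w.1) t :=
      hd.comp_hasDerivAt t hl
    have h2 := h1.norm_sq
    have h3 : HasDerivAt (fun t : ℝ => r + 1 - t) (-1) t := by
      simpa using (hasDerivAt_id t).const_sub (r + 1)
    exact h3.mul h2
  have hftc := intervalIntegral.integral_eq_sub_of_hasDerivAt hder hDc.intervalIntegrable
  have hRc : ContinuousOn (fun t => ‖μ (t • w.1)‖ ^ 2 +
      2 * (‖μ (t • w.1)‖ * ‖fderiv ℝ μ (t • w.1)‖)) (Set.uIcc r (r + 1)) := by fun_prop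
  have hval : ‖μ (r • w.1)‖ ^ 2 = ∫ t in r..(r + 1), - D t := by
    rw [intervalIntegral.integral_neg, hftc]; simp
  rw [hval, ← intervalIntegral.integral_of_le (by linarith)]
  refine intervalIntegral.integral_mono_on (by linarith) hDc.neg.intervalIntegrable
    hRc.intervalIntegrable fun t ht => ?_
  have hin : |inner ℝ (μ (t • w.1)) (fderiv ℝ μ (t • w.1) w.1)| ≤
      ‖μ (t • w.1)‖ * ‖fderiv ℝ μ (t • w.1)‖ := by
    refine (abs_real_inner_le_norm _ _).trans ?_
    gcongr
    have := (fderiv ℝ μ (t • w.1)).le_opNorm w.1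
    rwa [norm_eq_of_mem_sphere w, mul_one] at this
  have h1 : 0 ≤ r + 1 - t := by linarith [ht.2]
  have h2 : r + 1 - t ≤ 1 := by linarith [ht.1]
  have h3 := (abs_le.1 hin).1
  have h4 : 0 ≤ ‖μ (t • w.1)‖ * ‖fderiv ℝ μ (t • w.1)‖ := by positivity
  simp only [hD]
  set q := inner ℝ (μ (t • w.1)) (fderiv ℝ μ (t • w.1) w.1)
  set p := ‖μ (t • w.1)‖ * ‖fderiv ℝ μ (t • w.1)‖
  nlinarith [mul_nonneg h1 (by linarith : 0 ≤ p + q), mul_nonneg (by linarith : 0 ≤ t - r) h4]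

lemma main_bound (μ : E3 → ℂ) (hμ : ContDiffOn ℝ 1 μ {x : E3 | x ≠ 0})
    (hA : Integrable (fun x : E3 => ‖fderiv ℝ μ x‖ ^ 2 / ‖x‖ ^ 2))
    (hM : BddAbove (Mset μ)) {r : ℝ} (hr : 0 < r) :
    sphAvg μ r ≤ 200 * (Msup μ + Real.sqrt (Aint μ * Msup μ)) := by
  have hopen : IsOpen {x : E3 | x ≠ 0} := isOpen_ne
  have hc : ContinuousOn μ {x : E3 | x ≠ 0} := hμ.continuousOn
  have hdc : ContinuousOn (fderiv ℝ μ) {x : E3 | x ≠ 0} :=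
    hμ.continuousOn_fderiv_of_isOpen hopen le_rfl
  set π : Measure (S2 × ℝ) :=
    (μH[2] : Measure S2).prod (volume.restrict (Set.Ioc r (r + 1))) with hπ
  have hπ' : π = ((μH[2] : Measure S2).prod volume).restrict (Set.univ ×ˢ Set.Ioc r (r + 1)) := by
    rw [← Measure.prod_restrict, Measure.restrict_univ]
  have hw0 : ∀ w : S2, w.1 ≠ 0 := by
    intro w h
    have := norm_eq_of_mem_sphere w
    rw [h] at this
    simp at this
  set K : Set (S2 × ℝ) := Set.univ ×ˢ Set.Icc r (r + 1) with hK
  have hKc : IsCompact K := isCompact_univ.prod isCompact_Icc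
  have hint : ∀ f : S2 × ℝ → ℝ, ContinuousOn f K → Integrable f π := by
    intro f hf
    rw [hπ']
    exact (hf.integrableOn_compact hKc).mono_set (Set.prod_mono le_rfl Set.Ioc_subset_Icc_self)
  have hmaps : Set.MapsTo (fun p : S2 × ℝ => p.2 • p.1.1) K {x : E3 | x ≠ 0} := by
    intro p hp
    exact smul_ne_zero (hr.trans_le hp.2.1).ne' (hw0 _)
  have hsc : ContinuousOn (fun p : S2 × ℝ => p.2 • p.1.1) K := by fun_prop
  have c1 : ContinuousOn (fun p : S2 × ℝ => μ (p.2 • p.1.1)) K := hc.comp hsc hmaps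
  have c2 : ContinuousOn (fun p : S2 × ℝ => fderiv ℝ μ (p.2 • p.1.1)) K := hdc.comp hsc hmaps
  set f : S2 × ℝ → ℝ := fun p => ‖μ (p.2 • p.1.1)‖ with hf
  set g : S2 × ℝ → ℝ := fun p => ‖fderiv ℝ μ (p.2 • p.1.1)‖ with hg
  have cf : ContinuousOn f K := c1.norm
  have cg : ContinuousOn g K := c2.norm
  have if2 : Integrable (fun p => f p ^ 2) π := hint _ (cf.pow 2)
  have ig2 : Integrable (fun p => g p ^ 2) π := hint _ (cg.pow 2)
  have ifg : Integrable (fun p => f p * g p) π := hint _ (cf.mul cg)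
  have isum : Integrable (fun p => f p ^ 2 + 2 * (f p * g p)) π := if2.add (ifg.const_mul 2)
  -- first step
  have s1 : sphAvg μ r ≤ ∫ p, (f p ^ 2 + 2 * (f p * g p)) ∂π := by
    rw [sphAvg_eq μ hr, integral_prod _ isum]
    refine integral_mono ?_ isum.integral_prod_left fun w => pointwise μ hμ hr w
    have : Continuous fun w : S2 => ‖μ (r • w.1)‖ ^ 2 := by
      have : Continuous fun w : S2 => μ (r • w.1) :=
        hc.comp_continuous (by fun_prop) fun w => smul_ne_zero hr.ne' (hw0 w)
      exact this.norm.pow 2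
    rw [← integrableOn_univ]
    exact this.continuousOn.integrableOn_compact isCompact_univ
  have s2 : ∫ p, f p ^ 2 ∂π ≤ Msup μ := by
    have e : ∫ p, f p ^ 2 ∂π = ∫ t in r..(r + 1), sphAvg μ t := by
      rw [integral_prod_symm _ if2, intervalIntegral.integral_of_le (by linarith)]
      refine setIntegral_congr_fun measurableSet_Ioc fun t ht => ?_
      exact (sphAvg_eq μ (hr.trans ht.1)).symm
    rw [e]
    exact le_csSup hM ⟨r, hr, rfl⟩
  have s3 : ∫ p, g p ^ 2 ∂π ≤ 6144 * Aint μ := energy μ hr hA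
  have f0 : 0 ≤ ∫ p, f p ^ 2 ∂π := integral_nonneg fun p => by positivity
  have hA0 : 0 ≤ Aint μ := integral_nonneg fun x => by positivity
  have s4 : ∫ p, f p * g p ∂π ≤ Real.sqrt (∫ p, f p ^ 2 ∂π) * Real.sqrt (∫ p, g p ^ 2 ∂π) := by
    have mf : MemLp f (ENNReal.ofReal 2) π := by
      rw [ENNReal.ofReal_ofNat]
      exact (memLp_two_iff_integrable_sq (hint _ cf).aestronglyMeasurable).2 if2
    have mg : MemLp g (ENNReal.ofReal 2) π := by
      rw [ENNReal.ofReal_ofNat]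
      exact (memLp_two_iff_integrable_sq (hint _ cg).aestronglyMeasurable).2 ig2
    have := integral_mul_le_Lp_mul_Lq_of_nonneg Real.HolderConjugate.two_two
      (Filter.Eventually.of_forall fun p => norm_nonneg _)
      (Filter.Eventually.of_forall fun p => norm_nonneg _) mf mg
    simpa [Real.sqrt_eq_rpow] using this
  have s5 : ∫ p, f p * g p ∂π ≤ 80 * Real.sqrt (Aint μ * Msup μ) := by
    refine s4.trans ?_
    rw [← Real.sqrt_mul f0]
    have h80 : (80 : ℝ) = Real.sqrt (80 ^ 2) := (Real.sqrt_sq (by norm_num)).symm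
    rw [h80, ← Real.sqrt_mul (by positivity)]
    apply Real.sqrt_le_sqrt
    calc (∫ p, f p ^ 2 ∂π) * ∫ p, g p ^ 2 ∂π ≤ Msup μ * (6144 * Aint μ) := by
          apply mul_le_mul s2 s3 (integral_nonneg fun p => by positivity) (f0.trans s2)
      _ ≤ _ := by nlinarith [mul_nonneg hA0 (f0.trans s2)]
  rw [integral_add if2 (ifg.const_mul 2), integral_const_mul] at s1
  have := Real.sqrt_nonneg (Aint μ * Msup μ)
  linarith [f0.trans s2]

end Stmt10

/-- There is an absolute constant `C` such that for every `C¹` function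
`μ` on `ℝ³ ∖ {0}` with `A < ∞` and `M < ∞`, one has `sup_{r>0} m(r) ≤ C (M + √(A M))`. -/
theorem stmt_10 :
    ∃ C : ℝ, 0 < C ∧
      ∀ μ : EuclideanSpace ℝ (Fin 3) → ℂ,
        ContDiffOn ℝ 1 μ {x : EuclideanSpace ℝ (Fin 3) | x ≠ 0} →
        Integrable (fun x : EuclideanSpace ℝ (Fin 3) => ‖fderiv ℝ μ x‖ ^ 2 / ‖x‖ ^ 2) →
        BddAbove (Mset μ) →
        ∀ r : ℝ, 0 < r →
          sphAvg μ r ≤ C * (Msup μ + Real.sqrt (Aint μ * Msup μ)) := by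
  exact ⟨200, by norm_num, fun μ hμ hA hM r hr => Stmt10.main_bound μ hμ hA hM hr⟩
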